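/- For every n ≥ 0 and every A ∈ E^n with A ≠ S, one has H_e^n(A) = max( min_{∂A} H − min_A H , 0 ). -/

import Mathlib

open scoped ENNReal

namespace MetropolisCycles

variable {S : Type*} [Fintype S] [DecidableEq S]

/-- A path: a finite sequence of states whose consecutive members communicate. -/
def IsPath (q : S → S → ℝ) (ω : List S) : Prop :=
  ω.Chain' (fun a b => 0 < q a b)

/-- `x` and `y` are joined by a path entirely contained in `G`. -/
def JoinedIn (q : S → S → ℝ) (G : Set S) (x y : S) : Prop :=
  ∃ ω : List S, ω.head? = some x ∧ ω.getLast? = some y ∧ IsPath q ω ∧ ∀ z ∈ ω, z ∈ G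

/-- `G` is connected: any two of its points are joined by a path inside `G`. -/
def IsConnectedSet (q : S → S → ℝ) (G : Set S) : Prop :=
  ∀ x ∈ G, ∀ y ∈ G, JoinedIn q G x y

/-- The exterior boundary `∂G`. -/
def extBoundary (q : S → S → ℝ) (G : Set S) : Set S :=
  {y | y ∉ G ∧ ∃ x ∈ G, 0 < q x y}

/-- `A` is a non-trivial path cycle: connected and `max_A H < min_{∂A} H`. -/
def IsNontrivialPathCycle (H : S → ℝ) (q : S → S → ℝ) (A : Set S) : Prop :=
  A.Nonempty ∧ IsConnectedSet q A ∧ ∀ x ∈ A, ∀ y ∈ extBoundary q A, H x < H y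

/-- `A` is a path cycle: a singleton or a non-trivial path cycle. -/
def IsPathCycle (H : S → ℝ) (q : S → S → ℝ) (A : Set S) : Prop :=
  (∃ x, A = {x}) ∨ IsNontrivialPathCycle H q A

/-- The set of points joined to `x` by a path whose points all have energy at most `c`. -/
def energyCut (H : S → ℝ) (q : S → S → ℝ) (c : ℝ) (x : S) : Set S :=
  {y | JoinedIn q {z | H z ≤ c} x y}

/-- `U_{≤ x}`: the points joined to `x` by a path with energies at most `H x`. -/
def Ule (H : S → ℝ) (q : S → S → ℝ) (x : S) : Set S := energyCut H q (H x) x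

/-- The total cost of a path of cycles with respect to a cost function `Vs`. -/
noncomputable def listCost (Vs : Set S → Set S → ℝ≥0∞) : List (Set S) → ℝ≥0∞
  | [] => 0
  | [_] => 0
  | B :: B' :: l => Vs B B' + listCost Vs (B' :: l)

/-- `H_e` relative to a level `(E, V)` of the construction:
`H_e(A) = min { V(A,A') : A' ∈ E, A' ≠ A }`. -/
noncomputable def HeAux (E : Set (Set S)) (V : Set S → Set S → ℝ≥0∞) (A : Set S) : ℝ≥0∞ :=
  ⨅ A' ∈ E \ {A}, V A A'

/-- The renormalized cost function `V_* (A,B) = V(A,B) - H_e(A)`. -/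
noncomputable def VsAux (E : Set (Set S)) (V : Set S → Set S → ℝ≥0∞) (A B : Set S) : ℝ≥0∞ :=
  V A B - HeAux E V A

/-- `A →_k A'`: some path of elements of `E` from `A` to `A'` has zero total `V_*`-cost. -/
def arrowAux (E : Set (Set S)) (V : Set S → Set S → ℝ≥0∞) (A A' : Set S) : Prop :=
  ∃ l : List (Set S), l.head? = some A ∧ l.getLast? = some A' ∧ (∀ B ∈ l, B ∈ E) ∧
    listCost (VsAux E V) l = 0

/-- The set `D^{k+1}`: unions of the `R_k`-equivalence classes. -/
def DAux (E : Set (Set S)) (V : Set S → Set S → ℝ≥0∞) : Set (Set S) :=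
  {B | ∃ A ∈ E, B = ⋃₀ {A' | A' ∈ E ∧ arrowAux E V A A' ∧ arrowAux E V A' A}}

/-- The order relation `≥^{k+1}` on `D^{k+1}`. -/
def geqAux (E : Set (Set S)) (V : Set S → Set S → ℝ≥0∞) (B B' : Set S) : Prop :=
  ∃ C ∈ E, ∃ C' ∈ E, C ⊆ B ∧ C' ⊆ B' ∧ arrowAux E V C C'

/-- `D_*^{k+1}`: the minimal elements of `D^{k+1}` for `≥^{k+1}`. -/
def DstarAux (E : Set (Set S)) (V : Set S → Set S → ℝ≥0∞) : Set (Set S) :=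
  {B ∈ DAux E V | ∀ B' ∈ DAux E V, geqAux E V B B' → B' = B}

/-- `E^{k+1}` built from `(E^k, V^k)`. -/
def EnextAux (E : Set (Set S)) (V : Set S → Set S → ℝ≥0∞) : Set (Set S) :=
  DstarAux E V ∪ {A | A ∈ E ∧ ∃ B ∈ DAux E V \ DstarAux E V, A ⊆ B}

/-- `H_m^{k+1}(A) = max { H_e^k(A') : A' ∈ E^k, A' ⊆ A }`. -/
noncomputable def HmAux (E : Set (Set S)) (V : Set S → Set S → ℝ≥0∞) (A : Set S) : ℝ≥0∞ :=
  ⨆ A' ∈ {A' | A' ∈ E ∧ A' ⊆ A}, HeAux E V A'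

/-- `V^{k+1}(A,A') = H_m^{k+1}(A) + min { V_*^k(B,B') : B,B' ∈ E^k, B ⊆ A, B' ⊆ A' }`. -/
noncomputable def VnextAux (E : Set (Set S)) (V : Set S → Set S → ℝ≥0∞) (A A' : Set S) : ℝ≥0∞ :=
  HmAux E V A + ⨅ B ∈ {B | B ∈ E ∧ B ⊆ A}, ⨅ B' ∈ {B' | B' ∈ E ∧ B' ⊆ A'}, VsAux E V B B'

/-- The zero-order cost function `V^0({i},{j}) = (H j - H i)⁺` if `q i j > 0`, `∞` otherwise
(and `∞` on non-singletons). -/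
noncomputable def V0 (H : S → ℝ) (q : S → S → ℝ) (A B : Set S) : ℝ≥0∞ :=
  ⨅ i ∈ A, ⨅ j ∈ B, ⨅ _ : A = {i} ∧ B = {j} ∧ 0 < q i j, ENNReal.ofReal (H j - H i)

/-- The recursive construction `k ↦ (E^k, V^k)`. -/
noncomputable def cycEV (H : S → ℝ) (q : S → S → ℝ) : ℕ → Set (Set S) × (Set S → Set S → ℝ≥0∞)
  | 0 => ({A | ∃ i, A = {i}}, V0 H q)
  | k + 1 => (EnextAux (cycEV H q k).1 (cycEV H q k).2,
              VnextAux (cycEV H q k).1 (cycEV H q k).2)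

/-- The `k`-th order set of graph cycles `E^k`. -/
noncomputable def Ecyc (H : S → ℝ) (q : S → S → ℝ) (k : ℕ) : Set (Set S) := (cycEV H q k).1

/-- The `k`-th order cost function `V^k`. -/
noncomputable def Vcyc (H : S → ℝ) (q : S → S → ℝ) (k : ℕ) : Set S → Set S → ℝ≥0∞ :=
  (cycEV H q k).2

/-- `H_e^k(A)`. -/
noncomputable def Hek (H : S → ℝ) (q : S → S → ℝ) (k : ℕ) (A : Set S) : ℝ≥0∞ :=
  HeAux (Ecyc H q k) (Vcyc H q k) A

/-- `H_m^k(A)` (defined for `k ≥ 1`; set to `0` at `k = 0`). -/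
noncomputable def Hmk (H : S → ℝ) (q : S → S → ℝ) : ℕ → Set S → ℝ≥0∞
  | 0 => fun _ => 0
  | k + 1 => fun A => HmAux (Ecyc H q k) (Vcyc H q k) A

/-- `D^{n+1}` (indexed by `n`). -/
noncomputable def Dcyc (H : S → ℝ) (q : S → S → ℝ) (n : ℕ) : Set (Set S) :=
  DAux (Ecyc H q n) (Vcyc H q n)

/-- `D_*^{n+1}` (indexed by `n`). -/
noncomputable def DstarCyc (H : S → ℝ) (q : S → S → ℝ) (n : ℕ) : Set (Set S) :=
  DstarAux (Ecyc H q n) (Vcyc H q n)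

/-- The set of graph cycles `C = ∪_k E^k`. -/
def GraphCycles (H : S → ℝ) (q : S → S → ℝ) : Set (Set S) := {A | ∃ k, A ∈ Ecyc H q k}

/-- `H_e(A) = sup { H_e^k(A) : k ≥ 0, A ∈ E^k }` (for a graph cycle `A ≠ S`). -/
noncomputable def HeC (H : S → ℝ) (q : S → S → ℝ) (A : Set S) : ℝ≥0∞ :=
  ⨆ k, ⨆ _ : A ∈ Ecyc H q k, Hek H q k A

/-- `H_m(A) = max( sup { H_e(B) : B ∈ C, B ⊆ A, B ≠ A }, 0 )` (for `|A| > 1`). -/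
noncomputable def HmC (H : S → ℝ) (q : S → S → ℝ) (A : Set S) : ℝ≥0∞ :=
  ⨆ B ∈ {B | B ∈ GraphCycles H q ∧ B ⊆ A ∧ B ≠ A}, HeC H q B

set_option linter.unusedSectionVars false

/-- The ground energy of `A`. -/
noncomputable def groundEnergy (H : S → ℝ) (A : Set S) : ℝ := sInf (H '' A)

/-- The energy level that has to be reached in order to leave `A`. -/
noncomputable def exitLevel (H : S → ℝ) (q : S → S → ℝ) (A : Set S) : ℝ :=
  max (sInf (H '' extBoundary q A)) (groundEnergy H A)

lemma csInf_image_le (H : S → ℝ) {A : Set S} {x : S} (hx : x ∈ A) : sInf (H '' A) ≤ H x :=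
  csInf_le (Set.toFinite _).bddBelow (Set.mem_image_of_mem H hx)

lemma exists_eq_csInf_image (H : S → ℝ) {A : Set S} (hA : A.Nonempty) :
    ∃ x ∈ A, H x = sInf (H '' A) :=
  (hA.image H).csInf_mem (Set.toFinite _)

lemma groundEnergy_le (H : S → ℝ) {A : Set S} {x : S} (hx : x ∈ A) : groundEnergy H A ≤ H x :=
  csInf_image_le H hx

lemma groundEnergy_le_exitLevel (H : S → ℝ) (q : S → S → ℝ) (A : Set S) :
    groundEnergy H A ≤ exitLevel H q A :=
  le_max_right _ _

lemma exitLevel_le_or_eq_groundEnergy (H : S → ℝ) (q : S → S → ℝ) {A : Set S} {y : S}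
    (hy : y ∈ extBoundary q A) : exitLevel H q A ≤ H y ∨ exitLevel H q A = groundEnergy H A := by
  have h := csInf_image_le H hy
  unfold exitLevel
  rcases le_total (sInf (H '' extBoundary q A)) (groundEnergy H A) with h' | h'
  · exact Or.inr (max_eq_right h')
  · exact Or.inl (by rwa [max_eq_left h'])

lemma iInf_ofReal_eq (H : S → ℝ) {A : Set S} (hA : A.Nonempty) (c : ℝ) :
    ⨅ y ∈ A, ENNReal.ofReal (H y - c) = ENNReal.ofReal (sInf (H '' A) - c) := by
  obtain ⟨x, hx, hxe⟩ := exists_eq_csInf_image H hA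
  refine le_antisymm (iInf₂_le_of_le x hx (by rw [hxe])) (le_iInf₂ fun y hy => ?_)
  exact ENNReal.ofReal_le_ofReal (sub_le_sub_right (csInf_image_le H hy) c)

lemma iInf_ofReal_eq_zero_iff (H : S → ℝ) (A : Set S) (c : ℝ) :
    ⨅ y ∈ A, ENNReal.ofReal (H y - c) = 0 ↔ ∃ y ∈ A, H y ≤ c := by
  constructor
  · intro h
    rcases A.eq_empty_or_nonempty with rfl | hA
    · simp at h
    · obtain ⟨x, hx, hxe⟩ := exists_eq_csInf_image H hA
      rw [iInf_ofReal_eq H hA, ENNReal.ofReal_eq_zero] at h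
      exact ⟨x, hx, by linarith⟩
  · rintro ⟨y, hy, hyc⟩
    refine le_antisymm (iInf₂_le_of_le y hy ?_) bot_le
    exact (ENNReal.ofReal_eq_zero.2 (by linarith)).le

lemma ofReal_sub_add_ofReal_sub {m L h : ℝ} (hm : m ≤ L) (hL : L ≤ h ∨ L = m) :
    ENNReal.ofReal (L - m) + ENNReal.ofReal (h - L) = ENNReal.ofReal (h - m) := by
  rcases hL with hL | rfl
  · rw [← ENNReal.ofReal_add (by linarith) (by linarith)]
    congr 1
    ring
  · simp

lemma exists_edge_of_isPath (q : S → S → ℝ) (A : Set S) (ω : List S) :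
    ∀ x y, ω.head? = some x → ω.getLast? = some y → IsPath q ω → x ∈ A → y ∉ A →
      (extBoundary q A).Nonempty := by
  induction ω with
  | nil => intro x y hx; simp at hx
  | cons a l ih =>
    intro x y hx hy hp hxA hyA
    obtain rfl : a = x := by simpa using hx
    cases l with
    | nil =>
      obtain rfl : a = y := by simpa using hy
      exact absurd hxA hyA
    | cons b l =>
      obtain ⟨hab, hp⟩ := List.isChain_cons_cons.1 hp
      by_cases hb : b ∈ A
      · exact ih b y rfl (by simpa using hy) hp hb hyA
      · exact ⟨b, hb, a, hxA, hab⟩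

lemma extBoundary_nonempty {q : S → S → ℝ} (hirr : ∀ x y : S, JoinedIn q Set.univ x y)
    {A : Set S} (hA : A.Nonempty) (hAS : A ≠ Set.univ) : (extBoundary q A).Nonempty := by
  obtain ⟨x, hx⟩ := hA
  obtain ⟨y, hy⟩ := (Set.ne_univ_iff_exists_notMem A).1 hAS
  obtain ⟨ω, hh, hl, hp, -⟩ := hirr x y
  exact exists_edge_of_isPath q A ω x y hh hl hp hx hy

/-- One step of the relation `→_k`. -/
def ZeroStep (E : Set (Set S)) (V : Set S → Set S → ℝ≥0∞) (A B : Set S) : Prop :=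
  A ∈ E ∧ B ∈ E ∧ VsAux E V A B = 0

lemma arrowAux_refl {E : Set (Set S)} {V : Set S → Set S → ℝ≥0∞} {A : Set S} (hA : A ∈ E) :
    arrowAux E V A A :=
  ⟨[A], rfl, rfl, by simpa using hA, rfl⟩

lemma ZeroStep.arrowAux {E : Set (Set S)} {V : Set S → Set S → ℝ≥0∞} {A B : Set S}
    (h : ZeroStep E V A B) : arrowAux E V A B :=
  ⟨[A, B], rfl, rfl, by simpa using ⟨h.1, h.2.1⟩, by simpa [listCost] using h.2.2⟩

lemma reflTransGen_of_arrowAux {E : Set (Set S)} {V : Set S → Set S → ℝ≥0∞} {A B : Set S}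
    (h : arrowAux E V A B) : Relation.ReflTransGen (ZeroStep E V) A B := by
  obtain ⟨l, hh, hl, hE, hc⟩ := h
  induction l generalizing A with
  | nil => simp at hh
  | cons C l ih =>
    obtain rfl : C = A := by simpa using hh
    cases l with
    | nil =>
      obtain rfl : C = B := by simpa using hl
      exact .refl
    | cons D l =>
      simp only [listCost, add_eq_zero] at hc
      refine .head ⟨hE _ (by simp), hE _ (by simp), hc.1⟩ ?_
      exact ih rfl (by simpa using hl) (fun X hX => hE X (List.mem_cons_of_mem _ hX)) hc.2

lemma ZeroStep.arrowAux_trans {E : Set (Set S)} {V : Set S → Set S → ℝ≥0∞} {A B C : Set S}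
    (h : ZeroStep E V A B) (h' : MetropolisCycles.arrowAux E V B C) :
    MetropolisCycles.arrowAux E V A C := by
  obtain ⟨l, hh, hl, hE, hc⟩ := h'
  cases l with
  | nil => simp at hh
  | cons D l =>
    obtain rfl : D = B := by simpa using hh
    refine ⟨A :: D :: l, rfl, by simpa using hl, ?_, by simp [listCost, h.2.2, hc]⟩
    intro X hX
    rcases List.mem_cons.1 hX with rfl | hX
    · exact h.1
    · exact hE X hX

lemma arrowAux_trans {E : Set (Set S)} {V : Set S → Set S → ℝ≥0∞} {A B C : Set S}
    (h : arrowAux E V A B) (h' : arrowAux E V B C) : arrowAux E V A C := by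
  replace h := reflTransGen_of_arrowAux h
  induction h using Relation.ReflTransGen.head_induction_on with
  | refl => exact h'
  | head hs _ ih => exact hs.arrowAux_trans ih

/-- The union of the `R_k`-class of `C`. -/
def classUnion (E : Set (Set S)) (V : Set S → Set S → ℝ≥0∞) (C : Set S) : Set S :=
  ⋃₀ {A' | A' ∈ E ∧ arrowAux E V C A' ∧ arrowAux E V A' C}

section Partition

variable {E : Set (Set S)} {V : Set S → Set S → ℝ≥0∞}

lemma subset_classUnion {C : Set S} (hC : C ∈ E) : C ⊆ classUnion E V C :=
  Set.subset_sUnion_of_mem ⟨hC, arrowAux_refl hC, arrowAux_refl hC⟩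

lemma classUnion_mem_DAux {C : Set S} (hC : C ∈ E) : classUnion E V C ∈ DAux E V :=
  ⟨C, hC, rfl⟩

lemma classUnion_congr {C C' : Set S} (h : arrowAux E V C C') (h' : arrowAux E V C' C) :
    classUnion E V C = classUnion E V C' := by
  unfold classUnion
  congr 1
  ext X
  exact and_congr_right fun _ =>
    ⟨fun hX => ⟨arrowAux_trans h' hX.1, arrowAux_trans hX.2 h⟩,
      fun hX => ⟨arrowAux_trans h hX.1, arrowAux_trans hX.2 h'⟩⟩

lemma arrowAux_of_mem_classUnion (hE : Setoid.IsPartition E) {C C' : Set S} (hC' : C' ∈ E) {x : S}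
    (hx' : x ∈ C') (hx : x ∈ classUnion E V C) : arrowAux E V C C' ∧ arrowAux E V C' C := by
  obtain ⟨X, ⟨hXE, hX⟩, hxX⟩ := hx
  rwa [Setoid.eq_of_mem_eqv_class hE.2 hC' hx' hXE hxX]

lemma eq_classUnion_of_mem (hE : Setoid.IsPartition E) {B C : Set S} (hB : B ∈ DAux E V)
    (hC : C ∈ E) {x : S} (hxC : x ∈ C) (hxB : x ∈ B) : B = classUnion E V C := by
  obtain ⟨A, -, rfl⟩ := hB
  have h := arrowAux_of_mem_classUnion hE hC hxC hxB
  exact classUnion_congr h.1 h.2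

/-- Elements of `E^{k+1}` are unions of elements of `E^k`. -/
lemma exists_subset_of_mem_EnextAux (hE : Setoid.IsPartition E) {A : Set S}
    (hA : A ∈ EnextAux E V) {x : S} (hx : x ∈ A) : ∃ C ∈ E, x ∈ C ∧ C ⊆ A := by
  rcases hA with hA | ⟨hA, -⟩
  · obtain ⟨C, ⟨hC, hxC⟩, -⟩ := hE.2 x
    refine ⟨C, hC, hxC, ?_⟩
    rw [eq_classUnion_of_mem hE hA.1 hC hxC hx]
    exact subset_classUnion hC
  · exact ⟨A, hA, hx, subset_rfl⟩

lemma isPartition_EnextAux (hE : Setoid.IsPartition E) : Setoid.IsPartition (EnextAux E V) := by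
  have hmixed : ∀ A ∈ DstarAux E V, ∀ C ∈ E, ∀ B ∈ DAux E V \ DstarAux E V, C ⊆ B →
      ∀ x ∈ A, x ∉ C := by
    intro A hA C hC B hB hCB x hxA hxC
    apply hB.2
    rwa [eq_classUnion_of_mem hE hB.1 hC hxC (hCB hxC),
      ← eq_classUnion_of_mem hE hA.1 hC hxC hxA]
  constructor
  · rintro (⟨⟨C, hC, h⟩, -⟩ | ⟨h, -⟩)
    · obtain ⟨x, hx⟩ := Setoid.nonempty_of_mem_partition hE hC
      have hx' : x ∈ (∅ : Set S) := h ▸ subset_classUnion hC hx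
      exact hx'
    · exact hE.1 h
  · intro x
    obtain ⟨C, ⟨hC, hxC⟩, -⟩ := hE.2 x
    have hex : ∃ A ∈ EnextAux E V, x ∈ A := by
      by_cases h : classUnion E V C ∈ DstarAux E V
      · exact ⟨_, Or.inl h, subset_classUnion hC hxC⟩
      · exact ⟨C, Or.inr ⟨hC, _, ⟨classUnion_mem_DAux hC, h⟩, subset_classUnion hC⟩, hxC⟩
    obtain ⟨A, hA, hxA⟩ := hex
    refine ⟨A, ⟨hA, hxA⟩, ?_⟩
    rintro B ⟨hB, hxB⟩
    rcases hA with hA | ⟨hA, A', hA', hAA'⟩ <;> rcases hB with hB | ⟨hB, B', hB', hBB'⟩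
    · rw [eq_classUnion_of_mem hE hA.1 hC hxC hxA, eq_classUnion_of_mem hE hB.1 hC hxC hxB]
    · exact absurd hxB (hmixed A hA B hB B' hB' hBB' x hxA)
    · exact absurd hxA (hmixed B hB A hA A' hA' hAA' x hxB)
    · exact Setoid.eq_of_mem_eqv_class hE.2 hB hxB hA hxA

lemma not_mem_of_mem_of_ne (hE : Setoid.IsPartition E) {A B : Set S} (hA : A ∈ E) (hB : B ∈ E)
    (hAB : A ≠ B) {x : S} (hx : x ∈ A) : x ∉ B :=
  fun hxB => hAB (Setoid.eq_of_mem_eqv_class hE.2 hA hx hB hxB)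

lemma ne_univ_of_ne (hE : Setoid.IsPartition E) {A B : Set S} (hA : A ∈ E) (hB : B ∈ E)
    (hAB : A ≠ B) : A ≠ Set.univ := by
  obtain ⟨x, hx⟩ := Setoid.nonempty_of_mem_partition hE hB
  rintro rfl
  exact not_mem_of_mem_of_ne hE hA hB hAB (Set.mem_univ x) hx

end Partition

/-- The properties of a level `(E, V)` that the renormalization preserves. -/
structure LevelInvariant (H : S → ℝ) (q : S → S → ℝ) (E : Set (Set S))
    (V : Set S → Set S → ℝ≥0∞) : Prop where
  isPartition : Setoid.IsPartition E
  le_exitLevel : ∀ A ∈ E, A ≠ Set.univ → ∀ x ∈ A, H x ≤ exitLevel H q A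
  cost_eq : ∀ A ∈ E, ∀ B ∈ E, A ≠ B →
    V A B = ⨅ y ∈ extBoundary q A ∩ B, ENNReal.ofReal (H y - groundEnergy H A)

namespace LevelInvariant

variable {H : S → ℝ} {q : S → S → ℝ} {E : Set (Set S)} {V : Set S → Set S → ℝ≥0∞}

lemma HeAux_eq_ofReal_sInf (I : LevelInvariant H q E V)
    (hirr : ∀ x y : S, JoinedIn q Set.univ x y) {A : Set S} (hA : A ∈ E) (hAS : A ≠ Set.univ) :
    HeAux E V A = ENNReal.ofReal (sInf (H '' extBoundary q A) - groundEnergy H A) := by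
  have hne := Setoid.nonempty_of_mem_partition I.isPartition hA
  rw [← iInf_ofReal_eq H (extBoundary_nonempty hirr hne hAS)]
  refine le_antisymm (le_iInf₂ fun y hy => ?_) (le_iInf₂ fun B hB => ?_)
  · obtain ⟨B, ⟨hB, hyB⟩, -⟩ := I.isPartition.2 y
    have hAB : A ≠ B := fun h => hy.1 (h ▸ hyB)
    refine iInf₂_le_of_le B ⟨hB, hAB.symm⟩ ?_
    rw [I.cost_eq A hA B hB hAB]
    exact iInf₂_le y ⟨hy, hyB⟩
  · rw [I.cost_eq A hA B hB.1 (Ne.symm hB.2)]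
    exact le_iInf₂ fun y hy => iInf₂_le y hy.1

lemma HeAux_eq (I : LevelInvariant H q E V)
    (hirr : ∀ x y : S, JoinedIn q Set.univ x y) {A : Set S} (hA : A ∈ E) (hAS : A ≠ Set.univ) :
    HeAux E V A = ENNReal.ofReal (exitLevel H q A - groundEnergy H A) := by
  rw [I.HeAux_eq_ofReal_sInf hirr hA hAS, exitLevel, ← max_sub_sub_right, sub_self,
    ENNReal.ofReal_max, ENNReal.ofReal_zero, max_eq_left zero_le]

lemma VsAux_eq (I : LevelInvariant H q E V) (hirr : ∀ x y : S, JoinedIn q Set.univ x y)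
    {A B : Set S} (hA : A ∈ E) (hB : B ∈ E) (hAB : A ≠ B) :
    VsAux E V A B = ⨅ y ∈ extBoundary q A ∩ B, ENNReal.ofReal (H y - exitLevel H q A) := by
  have hV : V A B = ENNReal.ofReal (exitLevel H q A - groundEnergy H A) +
      ⨅ y ∈ extBoundary q A ∩ B, ENNReal.ofReal (H y - exitLevel H q A) := by
    rw [I.cost_eq A hA B hB hAB, ENNReal.add_iInf₂]
    refine biInf_congr fun y hy => (ofReal_sub_add_ofReal_sub ?_ ?_).symm
    · exact groundEnergy_le_exitLevel H q A
    · exact exitLevel_le_or_eq_groundEnergy H q hy.1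
  rw [VsAux, I.HeAux_eq hirr hA (ne_univ_of_ne I.isPartition hA hB hAB), hV,
    ENNReal.add_sub_cancel_left ENNReal.ofReal_ne_top]

lemma exitLevel_le_of_zeroStep (I : LevelInvariant H q E V) (hsym : ∀ x y : S, q x y = q y x)
    (hirr : ∀ x y : S, JoinedIn q Set.univ x y) {A B : Set S} (h : ZeroStep E V A B) :
    exitLevel H q B ≤ exitLevel H q A := by
  obtain ⟨hA, hB, h⟩ := h
  rcases eq_or_ne A B with rfl | hAB
  · exact le_rfl
  rw [I.VsAux_eq hirr hA hB hAB, iInf_ofReal_eq_zero_iff] at h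
  obtain ⟨y, ⟨⟨-, x, hx, hxy⟩, hyB⟩, hyL⟩ := h
  have hxB : x ∈ extBoundary q B :=
    ⟨not_mem_of_mem_of_ne I.isPartition hA hB hAB hx, y, hyB, hsym x y ▸ hxy⟩
  refine max_le ((csInf_image_le H hxB).trans ?_) ((groundEnergy_le H hyB).trans hyL)
  exact I.le_exitLevel A hA (ne_univ_of_ne I.isPartition hA hB hAB) x hx

lemma exitLevel_le_of_arrowAux (I : LevelInvariant H q E V) (hsym : ∀ x y : S, q x y = q y x)
    (hirr : ∀ x y : S, JoinedIn q Set.univ x y) {A B : Set S} (h : arrowAux E V A B) :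
    exitLevel H q B ≤ exitLevel H q A := by
  replace h := reflTransGen_of_arrowAux h
  induction h with
  | refl => exact le_rfl
  | tail _ hs ih => exact (I.exitLevel_le_of_zeroStep hsym hirr hs).trans ih

lemma HmAux_eq (I : LevelInvariant H q E V) (hirr : ∀ x y : S, JoinedIn q Set.univ x y)
    {A : Set S} {L : ℝ} (hAS : A ≠ Set.univ) (hne : A.Nonempty)
    (hcov : ∀ x ∈ A, ∃ C ∈ E, x ∈ C ∧ C ⊆ A)
    (hL : ∀ C ∈ E, C ⊆ A → exitLevel H q C = L) :
    HmAux E V A = ENNReal.ofReal (L - groundEnergy H A) := by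
  have hHe : ∀ C ∈ E, C ⊆ A → HeAux E V C = ENNReal.ofReal (L - groundEnergy H C) := by
    intro C hC hCA
    rw [I.HeAux_eq hirr hC (fun h => hAS (Set.univ_subset_iff.1 (h ▸ hCA))), hL C hC hCA]
  refine le_antisymm (iSup₂_le fun C hC => ?_) ?_
  · rw [hHe C hC.1 hC.2]
    obtain ⟨x, hx, hxe⟩ :=
      exists_eq_csInf_image H (Setoid.nonempty_of_mem_partition I.isPartition hC.1)
    have h : groundEnergy H A ≤ groundEnergy H C := (groundEnergy_le H (hC.2 hx)).trans hxe.le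
    exact ENNReal.ofReal_le_ofReal (sub_le_sub_left h L)
  · obtain ⟨x, hx, hxe⟩ := exists_eq_csInf_image H hne
    obtain ⟨C, hC, hxC, hCA⟩ := hcov x hx
    refine le_iSup₂_of_le C ⟨hC, hCA⟩ ?_
    rw [hHe C hC hCA]
    have h : groundEnergy H C ≤ groundEnergy H A := (groundEnergy_le H hxC).trans hxe.le
    exact ENNReal.ofReal_le_ofReal (sub_le_sub_left h L)

lemma VnextAux_eq (I : LevelInvariant H q E V) (hirr : ∀ x y : S, JoinedIn q Set.univ x y)
    {A B : Set S} {L : ℝ} (hAne : A.Nonempty) (hBne : B.Nonempty) (hdisj : ∀ x ∈ B, x ∉ A)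
    (hA : ∀ x ∈ A, ∃ C ∈ E, x ∈ C ∧ C ⊆ A) (hB : ∀ x ∈ B, ∃ C ∈ E, x ∈ C ∧ C ⊆ B)
    (hL : ∀ C ∈ E, C ⊆ A → exitLevel H q C = L)
    (hbd : ∀ y ∈ extBoundary q A, L ≤ H y ∨ L = groundEnergy H A) :
    VnextAux E V A B =
      ⨅ y ∈ extBoundary q A ∩ B, ENNReal.ofReal (H y - groundEnergy H A) := by
  obtain ⟨b, hb⟩ := hBne
  have hAS : A ≠ Set.univ := fun h => hdisj b hb (h ▸ Set.mem_univ b)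
  have hne : ∀ C ∈ E, ∀ C' : Set S, C ⊆ A → C' ⊆ B → C ≠ C' := by
    rintro C hC C' hCA hCB rfl
    obtain ⟨x, hx⟩ := Setoid.nonempty_of_mem_partition I.isPartition hC
    exact hdisj x (hCB hx) (hCA hx)
  have hVs : ∀ C ∈ E, ∀ C' ∈ E, C ⊆ A → C' ⊆ B → VsAux E V C C' =
      ⨅ y ∈ extBoundary q C ∩ C', ENNReal.ofReal (H y - L) := by
    intro C hC C' hC' hCA hCB
    rw [I.VsAux_eq hirr hC hC' (hne C hC C' hCA hCB), hL C hC hCA]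
  have hinf : ⨅ C ∈ {C | C ∈ E ∧ C ⊆ A}, ⨅ C' ∈ {C' | C' ∈ E ∧ C' ⊆ B}, VsAux E V C C' =
      ⨅ y ∈ extBoundary q A ∩ B, ENNReal.ofReal (H y - L) := by
    refine le_antisymm (le_iInf₂ fun y hy => ?_)
      (le_iInf₂ fun C hC => le_iInf₂ fun C' hC' => ?_)
    · obtain ⟨⟨hyA, x, hx, hxy⟩, hyB⟩ := hy
      obtain ⟨C, hC, hxC, hCA⟩ := hA x hx
      obtain ⟨C', hC', hyC', hCB⟩ := hB y hyB
      refine iInf₂_le_of_le C ⟨hC, hCA⟩ (iInf₂_le_of_le C' ⟨hC', hCB⟩ ?_)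
      rw [hVs C hC C' hC' hCA hCB]
      exact iInf₂_le y ⟨⟨fun h => hyA (hCA h), x, hxC, hxy⟩, hyC'⟩
    · rw [hVs C hC.1 C' hC'.1 hC.2 hC'.2]
      refine le_iInf₂ fun y hy => ?_
      obtain ⟨⟨-, x, hx, hxy⟩, hyC'⟩ := hy
      exact iInf₂_le y ⟨⟨hdisj y (hC'.2 hyC'), x, hC.2 hx, hxy⟩, hC'.2 hyC'⟩
  have hAL : groundEnergy H A ≤ L := by
    obtain ⟨x, hx⟩ := hAne
    obtain ⟨C, hC, hxC, hCA⟩ := hA x hx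
    rw [← hL C hC hCA]
    exact (groundEnergy_le H hx).trans
      (I.le_exitLevel C hC (fun h => hAS (Set.univ_subset_iff.1 (h ▸ hCA))) x hxC)
  rw [VnextAux, hinf, I.HmAux_eq hirr hAS hAne hA hL, ENNReal.add_iInf₂]
  exact biInf_congr fun y hy => ofReal_sub_add_ofReal_sub hAL (hbd y hy.1)

/-- All constituents of a cycle of the next level have the same exit level. -/
lemma exists_exitLevel_eq (I : LevelInvariant H q E V) (hsym : ∀ x y : S, q x y = q y x)
    (hirr : ∀ x y : S, JoinedIn q Set.univ x y) {A : Set S} (hA : A ∈ EnextAux E V) :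
    ∃ L, (∀ C ∈ E, C ⊆ A → exitLevel H q C = L) ∧
      ((A ∈ E ∧ L = exitLevel H q A) ∨ ∀ y ∈ extBoundary q A, L ≤ H y) := by
  rcases hA with hA | ⟨hA, -⟩
  · have hL : ∀ C ∈ E, C ⊆ A → ∀ C' ∈ E, C' ⊆ A → exitLevel H q C ≤ exitLevel H q C' := by
      intro C hC hCA C' hC' hCA'
      obtain ⟨x, hx⟩ := Setoid.nonempty_of_mem_partition I.isPartition hC
      obtain ⟨x', hx'⟩ := Setoid.nonempty_of_mem_partition I.isPartition hC'
      have hAC := eq_classUnion_of_mem I.isPartition hA.1 hC hx (hCA hx)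
      have h := arrowAux_of_mem_classUnion I.isPartition hC' hx' (hAC ▸ hCA' hx')
      exact I.exitLevel_le_of_arrowAux hsym hirr h.2
    obtain ⟨C, hC, hAC⟩ := hA.1
    have hCA : C ⊆ A := hAC ▸ subset_classUnion hC
    refine ⟨exitLevel H q C, fun C' hC' hCA' =>
      le_antisymm (hL _ hC' hCA' _ hC hCA) (hL _ hC hCA _ hC' hCA'), Or.inr ?_⟩
    rintro y ⟨hyA, x, hx, hxy⟩
    by_contra! hlt
    obtain ⟨B, hB, hxB, hBA⟩ :=
      exists_subset_of_mem_EnextAux I.isPartition (Or.inl hA) hx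
    obtain ⟨D, ⟨hD, hyD⟩, -⟩ := I.isPartition.2 y
    have hBD : B ≠ D := fun h => hyA (hBA (h ▸ hyD))
    have hstep : ZeroStep E V B D := by
      refine ⟨hB, hD, ?_⟩
      rw [I.VsAux_eq hirr hB hD hBD, iInf_ofReal_eq_zero_iff]
      exact ⟨y, ⟨⟨fun h => hyA (hBA h), x, hxB, hxy⟩, hyD⟩,
        hlt.le.trans (hL _ hC hCA _ hB hBA)⟩
    have hDA := hA.2 _ (classUnion_mem_DAux hD)
      ⟨B, hB, D, hD, hBA, subset_classUnion hD, hstep.arrowAux⟩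
    exact hyA (hDA ▸ subset_classUnion hD hyD)
  · refine ⟨exitLevel H q A, fun C hC hCA => ?_, Or.inl ⟨hA, rfl⟩⟩
    obtain ⟨x, hx⟩ := Setoid.nonempty_of_mem_partition I.isPartition hC
    rw [Setoid.eq_of_mem_eqv_class I.isPartition.2 hC hx hA (hCA hx)]

lemma next (I : LevelInvariant H q E V) (hsym : ∀ x y : S, q x y = q y x)
    (hirr : ∀ x y : S, JoinedIn q Set.univ x y) :
    LevelInvariant H q (EnextAux E V) (VnextAux E V) where
  isPartition := isPartition_EnextAux I.isPartition
  le_exitLevel A hA hAS x hx := by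
    obtain ⟨L, hL, ⟨hAE, -⟩ | hbd⟩ := I.exists_exitLevel_eq hsym hirr hA
    · exact I.le_exitLevel A hAE hAS x hx
    · obtain ⟨C, hC, hxC, hCA⟩ := exists_subset_of_mem_EnextAux I.isPartition hA hx
      obtain ⟨y, hy, hye⟩ := exists_eq_csInf_image H (extBoundary_nonempty hirr ⟨x, hx⟩ hAS)
      calc H x ≤ exitLevel H q C :=
            I.le_exitLevel C hC (fun h => hAS (Set.univ_subset_iff.1 (h ▸ hCA))) x hxC
        _ = L := hL C hC hCA
        _ ≤ H y := hbd y hy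
        _ = sInf (H '' extBoundary q A) := hye
        _ ≤ exitLevel H q A := le_max_left _ _
  cost_eq A hA B hB hAB := by
    have hP := isPartition_EnextAux (V := V) I.isPartition
    obtain ⟨L, hL, hbd⟩ := I.exists_exitLevel_eq hsym hirr hA
    refine I.VnextAux_eq hirr (Setoid.nonempty_of_mem_partition hP hA)
      (Setoid.nonempty_of_mem_partition hP hB)
      (fun x hx => not_mem_of_mem_of_ne hP hB hA hAB.symm hx)
      (fun x hx => exists_subset_of_mem_EnextAux I.isPartition hA hx)
      (fun x hx => exists_subset_of_mem_EnextAux I.isPartition hB hx) hL fun y hy => ?_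
    rcases hbd with ⟨-, rfl⟩ | hbd
    · exact exitLevel_le_or_eq_groundEnergy H q hy
    · exact Or.inl (hbd y hy)

end LevelInvariant

lemma levelInvariant_zero (H : S → ℝ) (q : S → S → ℝ) :
    LevelInvariant H q {A | ∃ i, A = {i}} (V0 H q) where
  isPartition := by
    refine ⟨?_, fun x => ⟨{x}, ⟨⟨x, rfl⟩, rfl⟩, ?_⟩⟩
    · rintro ⟨i, hi⟩
      exact Set.singleton_ne_empty i hi.symm
    · rintro _ ⟨⟨i, rfl⟩, hi⟩
      rw [Set.mem_singleton_iff.1 hi]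
  le_exitLevel := by
    rintro _ ⟨i, rfl⟩ - x rfl
    exact le_max_of_le_right (by simp [groundEnergy])
  cost_eq := by
    rintro _ ⟨i, rfl⟩ _ ⟨j, rfl⟩ hij
    have hji : j ≠ i := fun h => hij (h ▸ rfl)
    refine le_antisymm (le_iInf₂ fun y hy => ?_) ?_
    · obtain ⟨⟨-, x, hx, hxy⟩, hyj⟩ := hy
      obtain rfl : x = i := hx
      obtain rfl : y = j := hyj
      refine iInf₂_le_of_le x rfl (iInf₂_le_of_le y rfl (iInf_le_of_le ⟨rfl, rfl, hxy⟩ ?_))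
      simp [groundEnergy]
    · refine le_iInf₂ fun x hx => le_iInf₂ fun y hy => le_iInf fun h => ?_
      obtain rfl : x = i := hx
      obtain rfl : y = j := hy
      refine iInf₂_le_of_le y ⟨⟨hji, x, rfl, h.2.2⟩, rfl⟩ ?_
      simp [groundEnergy]

lemma levelInvariant_cyc (H : S → ℝ) (q : S → S → ℝ) (hsym : ∀ x y : S, q x y = q y x)
    (hirr : ∀ x y : S, JoinedIn q Set.univ x y) (n : ℕ) :
    LevelInvariant H q (Ecyc H q n) (Vcyc H q n) := by
  induction n with
  | zero => exact levelInvariant_zero H q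
  | succ k ih => exact ih.next hsym hirr

/-- For every `n ≥ 0` and `A ∈ E^n` with `A ≠ S`,
`H_e^n(A) = max(min_{∂A} H - min_A H, 0)`. -/
theorem Hek_eq (H : S → ℝ) (q : S → S → ℝ)
    (hq : ∀ x y : S, 0 ≤ q x y ∧ q x y ≤ 1)
    (hsum : ∀ x : S, ∑ y ∈ Finset.univ.erase x, q x y ≤ 1)
    (hsym : ∀ x y : S, q x y = q y x)
    (hirr : ∀ x y : S, JoinedIn q Set.univ x y)
    (n : ℕ) (A : Set S) (hA : A ∈ Ecyc H q n) (hAS : A ≠ Set.univ) :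
    Hek H q n A = ENNReal.ofReal (sInf (H '' extBoundary q A) - sInf (H '' A)) := by
  exact (levelInvariant_cyc H q hsym hirr n).HeAux_eq_ofReal_sInf hirr hA hAS

end MetropolisCycles
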